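/- arXiv:2602.01295 — 2 statements merged into one kernel-verified Lean document; each statement's English description precedes it below -/
import Mathlib

section
/- Second-moment bound of the shifted loss: for every state-action pair (s,a), 𝔼[(ℓ̃^{shift}(s,a))²] ≤ 2H²·(1 − π(a|s))·C^{2−α} σ² t^{2/α − 1} · x(s,a)^{2/α − 2}, where the expectation is over both the random trajectory and the random losses. -/
open Finset MeasureTheory

open scoped Classical

theorem sq_mul_rpow_le_mul_rpow {r y w γ : ℝ} (hr0 : 0 ≤ r) (hr1 : r ≤ 1) (hy : 0 < y)
    (hyw : y * r ≤ w) (hγ0 : γ ≤ 0) (hγ1 : -1 ≤ γ) : r ^ 2 * w ^ γ ≤ r * y ^ γ := by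
  rcases hr0.eq_or_lt with rfl | hr
  · simp
  calc r ^ 2 * w ^ γ ≤ r ^ 2 * (y * r) ^ γ := by
        gcongr ?_ * ?_
        exact Real.rpow_le_rpow_of_nonpos (by positivity) hyw hγ0
    _ = r ^ 2 * (r ^ γ * y ^ γ) := by rw [Real.mul_rpow hy.le hr.le]; ring
    _ ≤ r ^ 2 * (r ^ (-1 : ℝ) * y ^ γ) := by
        gcongr r ^ 2 * (?_ * y ^ γ)
        exact Real.rpow_le_rpow_of_exponent_ge hr hr1 hγ1
    _ = r * y ^ γ := by
        rw [Real.rpow_neg_one]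
        field_simp

section LayeredMDP

variable {S A : Type*}
  {H : ℕ} {layer : S → ℕ} {s1 : S} {P : S → A → S → ℝ} {π x : S → A → ℝ}
  {Q : (S → A → ℝ) → S → A → ℝ} {V : (S → A → ℝ) → S → ℝ}

/-- The loss which is one at the pair `z` and zero elsewhere. -/
noncomputable def unitLoss (z : S × A) (s : S) (a : A) : ℝ := if (s, a) = z then 1 else 0

theorem unitLoss_nonneg (z : S × A) (s : S) (a : A) : 0 ≤ unitLoss z s a := by
  unfold unitLoss; split_ifs <;> norm_num

theorem layer_backward_induction (hlayer : ∀ s : S, 1 ≤ layer s ∧ layer s ≤ H) {M : S → Prop}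
    (step : ∀ s, (∀ s', layer s' = layer s + 1 → M s') → M s) (s : S) : M s := by
  induction hn : H - layer s using Nat.strong_induction_on generalizing s with
  | _ n ih =>
    refine step s fun s' hs' => ih (H - layer s') ?_ s' rfl
    have := (hlayer s').2
    omega

theorem sum_transition_le [Fintype S] (hP_nonneg : ∀ s a s', 0 ≤ P s a s')
    (hP_supp : ∀ s a s', P s a s' ≠ 0 → layer s' = layer s + 1)
    (hlayer : ∀ s : S, 1 ≤ layer s ∧ layer s ≤ H)
    (hP_sum : ∀ s a, layer s < H → ∑ s', P s a s' = 1)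
    {f : S → ℝ} {c : ℝ} (hc : 0 ≤ c) (s : S) (a : A)
    (hf : ∀ s', layer s' = layer s + 1 → f s' ≤ c) : ∑ s', P s a s' * f s' ≤ c := by
  have hle : ∑ s', P s a s' ≤ 1 := by
    by_cases h : layer s < H
    · exact (hP_sum s a h).le
    · have hz : ∀ s', P s a s' = 0 := fun s' => by
        by_contra hne
        have := hP_supp s a s' hne
        have := (hlayer s').2
        omega
      simp [hz]
  calc ∑ s', P s a s' * f s' ≤ ∑ s', P s a s' * c := by
        refine sum_le_sum fun s' _ => ?_
        by_cases h : P s a s' = 0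
        · simp [h]
        · exact mul_le_mul_of_nonneg_left (hf s' (hP_supp s a s' h)) (hP_nonneg s a s')
    _ = (∑ s', P s a s') * c := (sum_mul ..).symm
    _ ≤ 1 * c := mul_le_mul_of_nonneg_right hle hc
    _ = c := one_mul c

theorem value_le_of_forall_le [Fintype A] (hπ_nonneg : ∀ s a, 0 ≤ π s a) (hπ_sum : ∀ s, ∑ a, π s a = 1)
    (hV : ∀ ℓ s, V ℓ s = ∑ a, π s a * Q ℓ s a) {ℓ : S → A → ℝ} {s : S} {c : ℝ}
    (h : ∀ a, Q ℓ s a ≤ c) : V ℓ s ≤ c := by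
  rw [hV]
  calc ∑ a, π s a * Q ℓ s a ≤ ∑ a, π s a * c :=
        sum_le_sum fun a _ => mul_le_mul_of_nonneg_left (h a) (hπ_nonneg s a)
    _ = c := by rw [← sum_mul, hπ_sum, one_mul]

variable [Fintype S] [Fintype A]

theorem sum_mul_unitLoss (ℓ : S → A → ℝ) (s : S) (a : A) :
    ∑ z : S × A, ℓ z.1 z.2 * unitLoss z s a = ℓ s a := by
  simp [unitLoss]

theorem qValue_eq_sum_unitLoss (hlayer : ∀ s : S, 1 ≤ layer s ∧ layer s ≤ H)
    (hP_supp : ∀ s a s', P s a s' ≠ 0 → layer s' = layer s + 1)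
    (hQ : ∀ ℓ s a, Q ℓ s a = ℓ s a + ∑ s', P s a s' * V ℓ s')
    (hV : ∀ ℓ s, V ℓ s = ∑ a, π s a * Q ℓ s a) (ℓ : S → A → ℝ) (s : S) :
    ∀ a, Q ℓ s a = ∑ z : S × A, ℓ z.1 z.2 * Q (unitLoss z) s a := by
  refine layer_backward_induction hlayer
    (M := fun s => ∀ a, Q ℓ s a = ∑ z : S × A, ℓ z.1 z.2 * Q (unitLoss z) s a) ?_ s
  intro s ih a
  have key : ∀ s', P s a s' * V ℓ s'
      = ∑ z : S × A, ℓ z.1 z.2 * (P s a s' * V (unitLoss z) s') := by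
    intro s'
    by_cases h : P s a s' = 0
    · simp [h]
    · have ih' := ih s' (hP_supp s a s' h)
      simp_rw [hV, ih', mul_sum]
      rw [sum_comm]
      exact sum_congr rfl fun z _ => sum_congr rfl fun b _ => by ring
  rw [hQ, sum_congr rfl fun s' _ => key s', sum_comm]
  simp_rw [hQ _ s a, mul_add, sum_add_distrib, sum_mul_unitLoss, mul_sum]

theorem vValue_eq_sum_unitLoss (hlayer : ∀ s : S, 1 ≤ layer s ∧ layer s ≤ H)
    (hP_supp : ∀ s a s', P s a s' ≠ 0 → layer s' = layer s + 1)
    (hQ : ∀ ℓ s a, Q ℓ s a = ℓ s a + ∑ s', P s a s' * V ℓ s')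
    (hV : ∀ ℓ s, V ℓ s = ∑ a, π s a * Q ℓ s a) (ℓ : S → A → ℝ) (s : S) :
    V ℓ s = ∑ z : S × A, ℓ z.1 z.2 * V (unitLoss z) s := by
  simp_rw [hV, qValue_eq_sum_unitLoss hlayer hP_supp hQ hV ℓ s, mul_sum]
  rw [sum_comm]
  exact sum_congr rfl fun z _ => sum_congr rfl fun b _ => by ring

theorem qValue_nonneg (hlayer : ∀ s : S, 1 ≤ layer s ∧ layer s ≤ H)
    (hP_nonneg : ∀ s a s', 0 ≤ P s a s')
    (hP_supp : ∀ s a s', P s a s' ≠ 0 → layer s' = layer s + 1)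
    (hπ_nonneg : ∀ s a, 0 ≤ π s a)
    (hQ : ∀ ℓ s a, Q ℓ s a = ℓ s a + ∑ s', P s a s' * V ℓ s')
    (hV : ∀ ℓ s, V ℓ s = ∑ a, π s a * Q ℓ s a) {ℓ : S → A → ℝ} (hℓ : ∀ s a, 0 ≤ ℓ s a)
    (s : S) : ∀ a, 0 ≤ Q ℓ s a := by
  refine layer_backward_induction hlayer (M := fun s => ∀ a, 0 ≤ Q ℓ s a) ?_ s
  intro s ih a
  rw [hQ]
  refine add_nonneg (hℓ s a) (sum_nonneg fun s' _ => ?_)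
  by_cases h : P s a s' = 0
  · simp [h]
  · rw [hV]
    exact mul_nonneg (hP_nonneg s a s') (sum_nonneg fun b _ =>
      mul_nonneg (hπ_nonneg s' b) (ih s' (hP_supp s a s' h) b))

theorem qValue_unitLoss_le_one (hlayer : ∀ s : S, 1 ≤ layer s ∧ layer s ≤ H)
    (hP_nonneg : ∀ s a s', 0 ≤ P s a s')
    (hP_supp : ∀ s a s', P s a s' ≠ 0 → layer s' = layer s + 1)
    (hP_sum : ∀ s a, layer s < H → ∑ s', P s a s' = 1)
    (hπ_nonneg : ∀ s a, 0 ≤ π s a) (hπ_sum : ∀ s, ∑ a, π s a = 1)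
    (hQ : ∀ ℓ s a, Q ℓ s a = ℓ s a + ∑ s', P s a s' * V ℓ s')
    (hV : ∀ ℓ s, V ℓ s = ∑ a, π s a * Q ℓ s a) (z : S × A) (s : S) (a : A) :
    Q (unitLoss z) s a ≤ 1 := by
  have main : ∀ a, Q (unitLoss z) s a ≤ if layer s ≤ layer z.1 then 1 else 0 := by
    refine layer_backward_induction hlayer
      (M := fun s => ∀ a, Q (unitLoss z) s a ≤ if layer s ≤ layer z.1 then 1 else 0) ?_ s
    intro s ih a
    have ihV : ∀ s', layer s' = layer s + 1 →
        V (unitLoss z) s' ≤ if layer s + 1 ≤ layer z.1 then 1 else 0 := fun s' hs' => by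
      have := value_le_of_forall_le hπ_nonneg hπ_sum hV (ih s' hs')
      rwa [hs'] at this
    have hnext := sum_transition_le hP_nonneg hP_supp hlayer hP_sum
      (by split_ifs <;> norm_num) s a ihV
    rw [hQ]
    refine (add_le_add_right hnext _).trans ?_
    by_cases hz : (s, a) = z
    · subst hz
      simp [unitLoss]
    · simp only [unitLoss, if_neg hz, zero_add]
      split_ifs <;> first | omega | norm_num
  refine (main a).trans ?_
  split_ifs <;> norm_num

theorem qValue_one_le (hlayer : ∀ s : S, 1 ≤ layer s ∧ layer s ≤ H)
    (hP_nonneg : ∀ s a s', 0 ≤ P s a s')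
    (hP_supp : ∀ s a s', P s a s' ≠ 0 → layer s' = layer s + 1)
    (hP_sum : ∀ s a, layer s < H → ∑ s', P s a s' = 1)
    (hπ_nonneg : ∀ s a, 0 ≤ π s a) (hπ_sum : ∀ s, ∑ a, π s a = 1)
    (hQ : ∀ ℓ s a, Q ℓ s a = ℓ s a + ∑ s', P s a s' * V ℓ s')
    (hV : ∀ ℓ s, V ℓ s = ∑ a, π s a * Q ℓ s a) (s : S) (a : A) :
    Q (fun _ _ => 1) s a ≤ H := by
  have main : ∀ a, Q (fun _ _ => 1) s a ≤ (H : ℝ) + 1 - layer s := by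
    refine layer_backward_induction hlayer
      (M := fun s => ∀ a, Q (fun _ _ => 1) s a ≤ (H : ℝ) + 1 - layer s) ?_ s
    intro s ih a
    have hs : (layer s : ℝ) ≤ H := by exact_mod_cast (hlayer s).2
    have hnext := sum_transition_le hP_nonneg hP_supp hlayer hP_sum
      (f := V fun _ _ => 1) (c := (H : ℝ) - layer s) (by linarith) s a fun s' hs' => by
        have := value_le_of_forall_le hπ_nonneg hπ_sum hV (ih s' hs')
        rw [hs'] at this
        push_cast at this
        linarith
    rw [hQ]
    linarith
  have hs : (1 : ℝ) ≤ layer s := by exact_mod_cast (hlayer s).1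
  linarith [main a]

theorem occupancy_mul_sum (hlayer : ∀ s : S, 1 ≤ layer s ∧ layer s ≤ H)
    (hs1 : ∀ s : S, (layer s = 1 ↔ s = s1)) (hπ_sum : ∀ s, ∑ a, π s a = 1)
    (hx_init : ∀ a, x s1 a = π s1 a)
    (hx_rec : ∀ s' a', 2 ≤ layer s' → x s' a' = π s' a' * ∑ s, ∑ a, P s a s' * x s a)
    (s : S) (a : A) : x s a = π s a * ∑ b, x s b := by
  by_cases h : layer s = 1
  · obtain rfl := (hs1 s).1 h
    simp_rw [hx_init, hπ_sum, mul_one]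
  · have h2 : 2 ≤ layer s := by have := (hlayer s).1; omega
    simp_rw [hx_rec s _ h2, ← sum_mul, hπ_sum, one_mul]

theorem sum_occupancy_mul_value_le (hlayer : ∀ s : S, 1 ≤ layer s ∧ layer s ≤ H)
    (hs1 : ∀ s : S, (layer s = 1 ↔ s = s1))
    (hP_nonneg : ∀ s a s', 0 ≤ P s a s')
    (hP_supp : ∀ s a s', P s a s' ≠ 0 → layer s' = layer s + 1)
    (hπ_nonneg : ∀ s a, 0 ≤ π s a) (hπ_sum : ∀ s, ∑ a, π s a = 1)
    (hx_init : ∀ a, x s1 a = π s1 a)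
    (hx_rec : ∀ s' a', 2 ≤ layer s' → x s' a' = π s' a' * ∑ s, ∑ a, P s a s' * x s a)
    (hx_pos : ∀ s a, 0 < x s a)
    (hQ : ∀ ℓ s a, Q ℓ s a = ℓ s a + ∑ s', P s a s' * V ℓ s')
    (hV : ∀ ℓ s, V ℓ s = ∑ a, π s a * Q ℓ s a) (z : S × A) (s : S) :
    (∑ b, x s b) * V (unitLoss z) s ≤ x z.1 z.2 := by
  have hVx : ∀ s, (∑ b, x s b) * V (unitLoss z) s = ∑ a, x s a * Q (unitLoss z) s a := by
    intro s
    rw [hV, mul_sum]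
    refine sum_congr rfl fun a _ => ?_
    rw [occupancy_mul_sum hlayer hs1 hπ_sum hx_init hx_rec s a]
    ring
  have hVnn : ∀ s, 0 ≤ V (unitLoss z) s := fun s => by
    rw [hV]
    exact sum_nonneg fun a _ => mul_nonneg (hπ_nonneg s a)
      (qValue_nonneg hlayer hP_nonneg hP_supp hπ_nonneg hQ hV (unitLoss_nonneg z) s a)
  have hstep : ∀ h, 1 ≤ h →
      ∑ s with layer s = h, (∑ b, x s b) * V (unitLoss z) s
        = ∑ s with layer s = h, ∑ a, x s a * unitLoss z s a
          + ∑ s with layer s = h + 1, (∑ b, x s b) * V (unitLoss z) s := by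
    intro h hh
    have hflow : ∀ s', layer s' = h + 1 →
        ∑ b, x s' b = ∑ s with layer s = h, ∑ a, P s a s' * x s a := by
      intro s' hs'
      rw [sum_congr rfl fun b _ => hx_rec s' b (by omega), ← sum_mul, hπ_sum, one_mul,
        sum_filter]
      refine sum_congr rfl fun s _ => ?_
      split_ifs with hl
      · rfl
      · refine sum_eq_zero fun a _ => ?_
        have : P s a s' = 0 := by
          by_contra hne
          have := hP_supp s a s' hne
          omega
        rw [this, zero_mul]
    have hsucc : ∑ s' with layer s' = h + 1, (∑ b, x s' b) * V (unitLoss z) s'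
        = ∑ s with layer s = h, ∑ a, x s a * ∑ s', P s a s' * V (unitLoss z) s' := by
      rw [sum_congr rfl fun s' hs' => by rw [hflow s' (mem_filter.1 hs').2]]
      simp_rw [sum_mul]
      rw [sum_comm]
      refine sum_congr rfl fun s hs => ?_
      rw [sum_comm]
      refine sum_congr rfl fun a _ => ?_
      rw [mul_sum, sum_filter]
      refine sum_congr rfl fun s' _ => ?_
      split_ifs with hl
      · ring
      · have : P s a s' = 0 := by
          by_contra hne
          have h1 := hP_supp s a s' hne
          have h2 := (mem_filter.1 hs).2
          omega
        rw [this]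
        ring
    rw [hsucc, ← sum_add_distrib]
    refine sum_congr rfl fun s _ => ?_
    rw [hVx, ← sum_add_distrib]
    exact sum_congr rfl fun a _ => by rw [hQ]; ring
  have hle : ∀ n h, 1 ≤ h → H < h + n →
      ∑ s with layer s = h, (∑ b, x s b) * V (unitLoss z) s
        ≤ ∑ s with h ≤ layer s, ∑ a, x s a * unitLoss z s a := by
    intro n
    induction n with
    | zero =>
      intro h _ hn
      rw [filter_false_of_mem fun s _ => by have := (hlayer s).2; omega,
        filter_false_of_mem fun s _ => by have := (hlayer s).2; omega]
      simp
    | succ n ih =>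
      intro h hh hn
      rw [hstep h hh]
      refine (add_le_add_right (ih (h + 1) (by omega) (by omega)) _).trans ?_
      rw [← sum_union]
      · refine le_of_eq (sum_congr ?_ fun _ _ => rfl)
        ext s
        simp only [mem_union, mem_filter, mem_univ, true_and]
        omega
      · rw [disjoint_filter]
        intro s _ _
        omega
  have hxnn : ∀ s a, 0 ≤ x s a * unitLoss z s a := fun s a =>
    mul_nonneg (hx_pos s a).le (unitLoss_nonneg z s a)
  calc (∑ b, x s b) * V (unitLoss z) s
      ≤ ∑ s' with layer s' = layer s, (∑ b, x s' b) * V (unitLoss z) s' :=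
        single_le_sum (f := fun s' => (∑ b, x s' b) * V (unitLoss z) s')
          (fun s' _ => mul_nonneg (sum_nonneg fun b _ => (hx_pos s' b).le) (hVnn s'))
          (by simp)
    _ ≤ ∑ s' with layer s ≤ layer s', ∑ a, x s' a * unitLoss z s' a :=
        hle (H + 1) (layer s) (hlayer s).1 (by omega)
    _ ≤ ∑ s', ∑ a, x s' a * unitLoss z s' a :=
        sum_le_sum_of_subset_of_nonneg (filter_subset _ _)
          fun s' _ _ => sum_nonneg fun a _ => hxnn s' a
    _ = x z.1 z.2 := by
        rw [← Fintype.sum_prod_type']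
        simp [unitLoss]

theorem sum_sq_advantage_mul_rpow_le (hlayer : ∀ s : S, 1 ≤ layer s ∧ layer s ≤ H)
    (hs1 : ∀ s : S, (layer s = 1 ↔ s = s1))
    (hP_nonneg : ∀ s a s', 0 ≤ P s a s')
    (hP_supp : ∀ s a s', P s a s' ≠ 0 → layer s' = layer s + 1)
    (hP_sum : ∀ s a, layer s < H → ∑ s', P s a s' = 1)
    (hπ_nonneg : ∀ s a, 0 ≤ π s a) (hπ_sum : ∀ s, ∑ a, π s a = 1)
    (hx_init : ∀ a, x s1 a = π s1 a)
    (hx_rec : ∀ s' a', 2 ≤ layer s' → x s' a' = π s' a' * ∑ s, ∑ a, P s a s' * x s a)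
    (hx_pos : ∀ s a, 0 < x s a)
    (hQ : ∀ ℓ s a, Q ℓ s a = ℓ s a + ∑ s', P s a s' * V ℓ s')
    (hV : ∀ ℓ s, V ℓ s = ∑ a, π s a * Q ℓ s a)
    {γ : ℝ} (hγ0 : γ ≤ 0) (hγ1 : -1 ≤ γ) (s : S) (a : A) :
    ∑ z : S × A, (Q (unitLoss z) s a - V (unitLoss z) s) ^ 2 * x z.1 z.2 ^ γ
      ≤ 2 * H * (1 - π s a) * x s a ^ γ := by
  have hπ1 : π s a ≤ 1 := by
    rw [← hπ_sum s]
    exact single_le_sum (fun b _ => hπ_nonneg s b) (mem_univ a)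
  have hq0 : ∀ z b, 0 ≤ Q (unitLoss z) s b := fun z b =>
    qValue_nonneg hlayer hP_nonneg hP_supp hπ_nonneg hQ hV (unitLoss_nonneg z) s b
  have hq1 : ∀ z b, Q (unitLoss z) s b ≤ 1 := fun z b =>
    qValue_unitLoss_le_one hlayer hP_nonneg hP_supp hP_sum hπ_nonneg hπ_sum hQ hV z s b
  have hreach : ∀ z, (∑ b, x s b) * V (unitLoss z) s ≤ x z.1 z.2 := fun z =>
    sum_occupancy_mul_value_le hlayer hs1 hP_nonneg hP_supp hπ_nonneg hπ_sum hx_init hx_rec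
      hx_pos hQ hV z s
  have hocc := occupancy_mul_sum hlayer hs1 hπ_sum hx_init hx_rec s a
  have hxle : x s a ≤ ∑ b, x s b :=
    single_le_sum (f := fun b => x s b) (fun b _ => (hx_pos s b).le) (mem_univ a)
  have hVsplit : ∀ ℓ, V ℓ s = π s a * Q ℓ s a + ∑ b ∈ univ.erase a, π s b * Q ℓ s b :=
    fun ℓ => by rw [hV, add_sum_erase _ (fun b => π s b * Q ℓ s b) (mem_univ a)]
  have hπrest : ∑ b ∈ univ.erase a, π s b = 1 - π s a := by
    rw [← hπ_sum s, ← add_sum_erase univ (π s) (mem_univ a), add_sub_cancel_left]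
  have htotal : ∀ b, ∑ z : S × A, Q (unitLoss z) s b ≤ H := fun b => by
    have h := qValue_one_le hlayer hP_nonneg hP_supp hP_sum hπ_nonneg hπ_sum hQ hV s b
    rw [qValue_eq_sum_unitLoss hlayer hP_supp hQ hV] at h
    simpa using h
  set v : S × A → ℝ := fun z => ∑ b ∈ univ.erase a, π s b * Q (unitLoss z) s b with hv
  have hv0 : ∀ z, 0 ≤ v z := fun z =>
    sum_nonneg fun b _ => mul_nonneg (hπ_nonneg s b) (hq0 z b)
  have hv1 : ∀ z, v z ≤ 1 := fun z =>
    calc v z ≤ ∑ b ∈ univ.erase a, π s b * 1 :=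
          sum_le_sum fun b _ => mul_le_mul_of_nonneg_left (hq1 z b) (hπ_nonneg s b)
      _ ≤ 1 := by rw [← sum_mul, hπrest]; linarith [hπ_nonneg s a]
  have hvtotal : ∑ z, v z ≤ (1 - π s a) * H := by
    rw [hv, sum_comm, ← hπrest, sum_mul]
    refine sum_le_sum fun b _ => ?_
    rw [← mul_sum]
    exact mul_le_mul_of_nonneg_left (htotal b) (hπ_nonneg s b)
  have hxv : ∀ z, x s a * v z ≤ x z.1 z.2 := fun z => by
    refine le_trans ?_ (hreach z)
    refine mul_le_mul hxle ?_ (hv0 z) ((hx_pos s a).le.trans hxle)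
    rw [hVsplit]
    exact le_add_of_nonneg_left (mul_nonneg (hπ_nonneg s a) (hq0 z a))
  have hxq : ∀ z, x s a * Q (unitLoss z) s a ≤ x z.1 z.2 := fun z => by
    refine le_trans ?_ (hreach z)
    rw [hVsplit, hocc]
    nlinarith [mul_nonneg ((hx_pos s a).le.trans hxle) (hv0 z)]
  have hterm : ∀ z : S × A, (Q (unitLoss z) s a - V (unitLoss z) s) ^ 2 * x z.1 z.2 ^ γ
      ≤ (1 - π s a) * (Q (unitLoss z) s a * x s a ^ γ) + v z * x s a ^ γ := by
    intro z
    have hsq : (Q (unitLoss z) s a - V (unitLoss z) s) ^ 2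
        ≤ (1 - π s a) * Q (unitLoss z) s a ^ 2 + v z ^ 2 := by
      rw [hVsplit, show Q (unitLoss z) s a - (π s a * Q (unitLoss z) s a +
        ∑ b ∈ univ.erase a, π s b * Q (unitLoss z) s b)
          = (1 - π s a) * Q (unitLoss z) s a - v z by rw [hv]; ring]
      have h1 : 0 ≤ (1 - π s a) * Q (unitLoss z) s a * v z :=
        mul_nonneg (mul_nonneg (by linarith) (hq0 z a)) (hv0 z)
      have h2 : 0 ≤ π s a * (1 - π s a) * Q (unitLoss z) s a ^ 2 :=
        mul_nonneg (mul_nonneg (hπ_nonneg s a) (by linarith)) (sq_nonneg _)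
      nlinarith
    have hq := sq_mul_rpow_le_mul_rpow (hq0 z a) (hq1 z a) (hx_pos s a) (hxq z) hγ0 hγ1
    have hvz := sq_mul_rpow_le_mul_rpow (hv0 z) (hv1 z) (hx_pos s a) (hxv z) hγ0 hγ1
    calc _ ≤ ((1 - π s a) * Q (unitLoss z) s a ^ 2 + v z ^ 2) * x z.1 z.2 ^ γ :=
          mul_le_mul_of_nonneg_right hsq (Real.rpow_nonneg (hx_pos _ _).le _)
      _ = (1 - π s a) * (Q (unitLoss z) s a ^ 2 * x z.1 z.2 ^ γ) + v z ^ 2 * x z.1 z.2 ^ γ := by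
          ring
      _ ≤ _ := add_le_add (mul_le_mul_of_nonneg_left hq (by linarith)) hvz
  refine (sum_le_sum fun z _ => hterm z).trans ?_
  rw [sum_add_distrib, ← mul_sum, ← sum_mul, ← sum_mul]
  have hγnn : 0 ≤ x s a ^ γ := Real.rpow_nonneg (hx_pos s a).le _
  have h1 := mul_le_mul_of_nonneg_left (mul_le_mul_of_nonneg_right (htotal a) hγnn)
    (show 0 ≤ 1 - π s a by linarith)
  have h2 := mul_le_mul_of_nonneg_right hvtotal hγnn
  linarith

end LayeredMDP

theorem sq_le_rpow_mul_abs_rpow {z τ α : ℝ} (hα0 : 0 ≤ α) (hα2 : α ≤ 2) (hz : |z| ≤ τ) :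
    z ^ 2 ≤ τ ^ (2 - α) * |z| ^ α := by
  have h : z ^ 2 = |z| ^ (2 - α) * |z| ^ α := by
    rw [← Real.rpow_add_of_nonneg (abs_nonneg z) (by linarith) hα0, sub_add_cancel,
      Real.rpow_two, sq_abs]
  rw [h]
  gcongr

theorem threshold_rpow_mul_rpow {C σ t w α : ℝ} (hC : 0 < C) (hσ : 0 < σ) (ht : 0 < t)
    (hw : 0 < w) (hα : α ≠ 0) :
    (C * σ * t ^ (1 / α) * w ^ (1 / α)) ^ (2 - α) * σ ^ α
      = C ^ (2 - α) * σ ^ 2 * t ^ (2 / α - 1) * w ^ (2 / α - 2) * w := by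
  have hσα : σ ^ (2 - α) * σ ^ α = σ ^ 2 := by
    rw [← Real.rpow_add hσ, sub_add_cancel, Real.rpow_two]
  have hexp : 1 / α * (2 - α) = 2 / α - 1 := by field_simp
  have hw' : w ^ (2 / α - 1) = w ^ (2 / α - 2) * w := by
    rw [← Real.rpow_add_one hw.ne']
    congr 1
    ring
  rw [Real.mul_rpow (by positivity) (by positivity), Real.mul_rpow (by positivity) (by positivity),
    Real.mul_rpow hC.le hσ.le, ← Real.rpow_mul ht.le, ← Real.rpow_mul hw.le, hexp, hw', ← hσα]
  ring

/-- Cauchy–Schwarz for a function supported on the range of a map from `Fin H`. -/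
theorem sq_sum_le_of_support_subset_range {ι : Type*} [Fintype ι] {H : ℕ} (T : Fin H → ι)
    (f : ι → ℝ) (hf : ∀ i, (¬ ∃ h, T h = i) → f i = 0) :
    (∑ i, f i) ^ 2 ≤ H * ∑ i, f i ^ 2 := by
  have hsub : ∀ g : ι → ℝ, (∀ i, (¬ ∃ h, T h = i) → g i = 0) →
      ∑ i ∈ univ.image T, g i = ∑ i, g i := fun g hg =>
    sum_subset (subset_univ _) fun i _ hi => hg i (by simpa using hi)
  rw [← hsub f hf, ← hsub (fun i => f i ^ 2) fun i hi => by simp [hf i hi]]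
  refine sq_sum_le_card_mul_sum_sq.trans ?_
  gcongr
  simpa using card_image_le (s := univ) (f := T)

/-- Second moment, conditionally on the trajectory `T`, of a linear combination of the truncated
importance-weighted losses. -/
theorem integral_sq_sum_truncated_le {ι : Type*} [Fintype ι] [DecidableEq ι] {H : ℕ} (T : Fin H → ι)
    {μ : ι → Measure ℝ} (hμ : ∀ i, IsProbabilityMeasure (μ i)) {α M : ℝ}
    (hα0 : 0 ≤ α) (hα2 : α ≤ 2)
    (hint : ∀ i, Integrable (fun z : ℝ => |z| ^ α) (μ i))
    (hmom : ∀ i, ∫ z : ℝ, |z| ^ α ∂(μ i) ≤ M)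
    (c w τ : ι → ℝ) (hτ : ∀ i, 0 ≤ τ i) :
    ∫ L : ι → ℝ, (∑ i, (if ∃ h, T h = i then (if |L i| ≤ τ i then L i else 0) / w i else 0)
        * c i) ^ 2 ∂(Measure.pi μ)
      ≤ H * ∑ i, c i ^ 2 * if ∃ h, T h = i then τ i ^ (2 - α) * M / w i ^ 2 else 0 := by
  set k : ι → ℝ := fun i => c i ^ 2 * if ∃ h, T h = i then τ i ^ (2 - α) / w i ^ 2 else 0 with hk
  have hk0 : ∀ i, 0 ≤ k i := fun i => by
    have := Real.rpow_nonneg (hτ i) (2 - α)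
    simp only [hk]
    split_ifs <;> positivity
  have hpiint : ∀ i, Integrable (fun L : ι → ℝ => k i * |L i| ^ α) (Measure.pi μ) := fun i =>
    ((measurePreserving_eval μ i).integrable_comp_of_integrable (hint i)).const_mul _
  have hpieval : ∀ i, ∫ L : ι → ℝ, |L i| ^ α ∂(Measure.pi μ) = ∫ z : ℝ, |z| ^ α ∂(μ i) :=
    fun i => integral_comp_eval (μ := μ) (f := fun z => |z| ^ α) (hint i).aestronglyMeasurable
  calc _ ≤ ∫ L : ι → ℝ, H * ∑ i, k i * |L i| ^ α ∂(Measure.pi μ) := by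
        refine integral_mono_of_nonneg (Filter.Eventually.of_forall fun L => sq_nonneg _)
          ((integrable_finsetSum _ fun i _ => hpiint i).const_mul _)
          (Filter.Eventually.of_forall fun L => ?_)
        refine (sq_sum_le_of_support_subset_range T _ fun i hi => by simp [hi]).trans ?_
        refine mul_le_mul_of_nonneg_left (sum_le_sum fun i _ => ?_) (Nat.cast_nonneg H)
        by_cases hi : ∃ h, T h = i
        · by_cases hL : |L i| ≤ τ i
          · have := sq_le_rpow_mul_abs_rpow hα0 hα2 hL
            simp only [hk, if_pos hi, if_pos hL]
            calc (L i / w i * c i) ^ 2 = c i ^ 2 / w i ^ 2 * L i ^ 2 := by ring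
              _ ≤ c i ^ 2 / w i ^ 2 * (τ i ^ (2 - α) * |L i| ^ α) := by gcongr
              _ = _ := by ring
          · simp only [if_pos hi, if_neg hL]
            simpa using mul_nonneg (hk0 i) (Real.rpow_nonneg (abs_nonneg (L i)) α)
        · simp [hk, hi]
    _ = H * ∑ i, k i * ∫ z : ℝ, |z| ^ α ∂(μ i) := by
        rw [integral_const_mul, integral_finsetSum _ fun i _ => hpiint i]
        simp_rw [integral_const_mul, hpieval]
    _ ≤ H * ∑ i, k i * M := by
        gcongr with i
        · exact hk0 i
        · exact hmom i
    _ = _ := by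
        congr 1
        refine sum_congr rfl fun i _ => ?_
        simp only [hk]
        split_ifs <;> ring

theorem stmt_2
    {S A : Type*} [Fintype S] [Fintype A] [Nonempty S] [Nonempty A]
    [DecidableEq S] [DecidableEq A]
    (H : ℕ) (hH : 1 ≤ H)
    (layer : S → ℕ)
    (hlayer : ∀ s : S, 1 ≤ layer s ∧ layer s ≤ H)
    (hlayer_ne : ∀ h : ℕ, 1 ≤ h → h ≤ H → ∃ s : S, layer s = h)
    (s1 : S) (hs1 : ∀ s : S, (layer s = 1 ↔ s = s1))
    (P : S → A → S → ℝ)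
    (hP_nonneg : ∀ s a s', 0 ≤ P s a s')
    (hP_supp : ∀ s a s', P s a s' ≠ 0 → layer s' = layer s + 1)
    (hP_sum : ∀ s a, layer s < H → ∑ s', P s a s' = 1)
    (π : S → A → ℝ)
    (hπ_nonneg : ∀ s a, 0 ≤ π s a)
    (hπ_sum : ∀ s, ∑ a, π s a = 1)
    (x : S → A → ℝ)
    (hx_init : ∀ a, x s1 a = π s1 a)
    (hx_rec : ∀ s' a', 2 ≤ layer s' → x s' a' = π s' a' * ∑ s, ∑ a, P s a s' * x s a)
    (hx_pos : ∀ s a, 0 < x s a)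
    (Q : (S → A → ℝ) → S → A → ℝ) (V : (S → A → ℝ) → S → ℝ)
    (hQ : ∀ ℓ s a, Q ℓ s a = ℓ s a + ∑ s', P s a s' * V ℓ s')
    (hV : ∀ ℓ s, V ℓ s = ∑ a, π s a * Q ℓ s a)
    (α σ C t : ℝ)
    (hα1 : 1 < α) (hα2 : α ≤ 2) (hσ : 0 < σ) (hC : 0 < C) (ht : 1 ≤ t)
    (p : (Fin H → S × A) → ℝ)
    (hp_nonneg : ∀ T, 0 ≤ p T)
    (hp_sum : ∑ T : Fin H → S × A, p T = 1)
    (hp_layer : ∀ T, p T ≠ 0 → ∀ h : Fin H, layer (T h).1 = (h : ℕ) + 1)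
    (hp_marg : ∀ s a,
      (∑ T ∈ Finset.univ.filter (fun T : Fin H → S × A => ∃ h, T h = (s, a)), p T) = x s a)
    (ν : (Fin H → S × A) → S × A → Measure ℝ)
    (hν_prob : ∀ T sa, IsProbabilityMeasure (ν T sa))
    (hν_int : ∀ T sa, p T ≠ 0 → Integrable (fun z : ℝ => |z| ^ α) (ν T sa))
    (hν_mom : ∀ T sa, p T ≠ 0 → (∫ z : ℝ, |z| ^ α ∂(ν T sa)) ≤ σ ^ α)
    (ℓskip : (Fin H → S × A) → ((S × A) → ℝ) → S → A → ℝ)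
    (hℓskip : ∀ T L s a, ℓskip T L s a =
      (if ∃ h : Fin H, T h = (s, a) then
        (if |L (s, a)| ≤ C * σ * t ^ (1/α) * x s a ^ (1/α) then L (s, a) else 0) / x s a
      else 0))
    :
    ∀ s a,
      (∑ T : Fin H → S × A, p T *
        (∫ (L : (S × A) → ℝ), (Q (ℓskip T L) s a - V (ℓskip T L) s) ^ 2
          ∂(Measure.pi fun sa => ν T sa)))
      ≤ 2 * (H : ℝ) ^ 2 * (1 - π s a) * C ^ (2 - α) * σ ^ 2 * t ^ (2/α - 1) *
          x s a ^ (2/α - 2) := by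
  intro s a
  have hα0 : 0 < α := by linarith
  have ht0 : 0 < t := by linarith
  set K : ℝ := C ^ (2 - α) * σ ^ 2 * t ^ (2/α - 1) with hK
  have hK0 : 0 ≤ K := by positivity
  set c : S × A → ℝ := fun z => Q (unitLoss z) s a - V (unitLoss z) s with hc
  have hshift : ∀ ℓ, Q ℓ s a - V ℓ s = ∑ z : S × A, ℓ z.1 z.2 * c z := fun ℓ => by
    rw [qValue_eq_sum_unitLoss hlayer hP_supp hQ hV ℓ,
      vValue_eq_sum_unitLoss hlayer hP_supp hQ hV ℓ, ← sum_sub_distrib]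
    exact sum_congr rfl fun z _ => (mul_sub ..).symm
  have hcond : ∀ T : Fin H → S × A, p T *
      (∫ L : (S × A) → ℝ, (Q (ℓskip T L) s a - V (ℓskip T L) s) ^ 2
        ∂(Measure.pi fun sa => ν T sa))
      ≤ p T * (H * ∑ z : S × A, c z ^ 2 *
        if ∃ h, T h = z then K * x z.1 z.2 ^ (2/α - 2) / x z.1 z.2 else 0) := by
    intro T
    by_cases hT : p T = 0
    · simp [hT]
    refine mul_le_mul_of_nonneg_left ?_ (hp_nonneg T)
    have h := integral_sq_sum_truncated_le T (hν_prob T) hα0.le hα2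
      (fun z => hν_int T z hT) (fun z => hν_mom T z hT) c (fun z => x z.1 z.2)
      (fun z => C * σ * t ^ (1/α) * x z.1 z.2 ^ (1/α)) fun z => by
        have := hx_pos z.1 z.2
        positivity
    simp_rw [hshift, hℓskip]
    refine h.trans_eq ?_
    congr 1
    refine sum_congr rfl fun z _ => ?_
    have hz := (hx_pos z.1 z.2).ne'
    rw [threshold_rpow_mul_rpow hC hσ ht0 (hx_pos z.1 z.2) hα0.ne', ← hK]
    congr 2
    field_simp
  have hmarg : ∀ z : S × A, ∑ T : Fin H → S × A, (if ∃ h, T h = z then p T else 0)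
      = x z.1 z.2 := fun z => by
    rw [← sum_filter]
    exact hp_marg z.1 z.2
  have hγ0 : 2 / α - 2 ≤ 0 := by
    rw [sub_nonpos, div_le_iff₀ hα0]
    linarith
  have hγ1 : -1 ≤ 2 / α - 2 := by
    have : 1 ≤ 2 / α := by rw [le_div_iff₀ hα0]; linarith
    linarith
  have hadv := sum_sq_advantage_mul_rpow_le hlayer hs1 hP_nonneg hP_supp hP_sum hπ_nonneg hπ_sum
    hx_init hx_rec hx_pos hQ hV hγ0 hγ1 s a
  calc _ ≤ ∑ T : Fin H → S × A, p T * (H * ∑ z : S × A, c z ^ 2 *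
        if ∃ h, T h = z then K * x z.1 z.2 ^ (2/α - 2) / x z.1 z.2 else 0) :=
        sum_le_sum fun T _ => hcond T
    _ = ∑ z : S × A, H * c z ^ 2 * (K * x z.1 z.2 ^ (2/α - 2) / x z.1 z.2) *
        ∑ T : Fin H → S × A, (if ∃ h, T h = z then p T else 0) := by
        simp_rw [mul_sum]
        rw [sum_comm]
        refine sum_congr rfl fun z _ => sum_congr rfl fun T _ => ?_
        split_ifs <;> ring
    _ = H * K * ∑ z : S × A, c z ^ 2 * x z.1 z.2 ^ (2/α - 2) := by
        rw [mul_sum]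
        refine sum_congr rfl fun z _ => ?_
        have hz := (hx_pos z.1 z.2).ne'
        rw [hmarg]
        field_simp
    _ ≤ H * K * (2 * H * (1 - π s a) * x s a ^ (2/α - 2)) :=
        mul_le_mul_of_nonneg_left hadv (by positivity)
    _ = _ := by rw [hK]; ring
end

section
/- Penalty bound: let x = ρ^{ℙ,π} be the occupancy measure of any policy π and ρ̊ = ρ^{ℙ,π̊} that of a deterministic policy π̊ in the layered MDP. Fix α ∈ (1,2], σ > 0, β > 0, and for each t ≥ 1 set Ψ_t(z) = −(1/η_t) ∑_{(s,a)} z(s,a)^{1/α} with η_t = β/(σ t^{1/α}). Then for every t ≥ 2, the penalty term pena_t := (Ψ_t(ρ̊) − Ψ_{t−1}(ρ̊)) − (Ψ_t(x) − Ψ_{t−1}(x)) satisfies pena_t ≤ (2 + 2 H^{1/α} S^{1 − 1/α}) · (σ/β) · t^{1/α − 1} · ∑_{(s,a): a ≠ π̊(s)} x(s,a)^{1/α}. -/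
open Finset MeasureTheory

open scoped Classical

/-- Subtracting consecutive powers: `t ^ p - (t - 1) ^ p ≤ t ^ (p - 1)` for `p ≤ 1`. -/
lemma rpow_sub_rpow_sub_one_le {t p : ℝ} (ht : 1 < t) (hp : p ≤ 1) :
    t ^ p - (t - 1) ^ p ≤ t ^ (p - 1) := by
  have h0 : 0 < t := by linarith
  have h1 : 0 < t - 1 := by linarith
  have hmono : t ^ (p - 1) ≤ (t - 1) ^ (p - 1) :=
    Real.rpow_le_rpow_of_nonpos h1 (by linarith) (by linarith)
  have e1 : t ^ p = t ^ (p - 1) * t := by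
    rw [← Real.rpow_add_one h0.ne']; ring_nf
  have e2 : (t - 1) ^ p = (t - 1) ^ (p - 1) * (t - 1) := by
    rw [← Real.rpow_add_one h1.ne']; ring_nf
  rw [e1, e2]
  nlinarith

lemma rpow_sum_le_sum_rpow {ι : Type*} (s : Finset ι) {f : ι → ℝ} {p : ℝ} (hp0 : 0 < p)
    (hp1 : p ≤ 1) (hf : ∀ i ∈ s, 0 ≤ f i) : (∑ i ∈ s, f i) ^ p ≤ ∑ i ∈ s, f i ^ p :=
  le_sum_of_subadditive_on_pred (fun y : ℝ => y ^ p) (fun y => 0 ≤ y)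
    (Real.zero_rpow hp0.ne').le (fun _ _ hx hy => Real.rpow_add_le_add_rpow hx hy hp0.le hp1)
    (fun _ _ hx hy => add_nonneg hx hy) f hf

lemma sum_rpow_one_div_le {ι : Type*} (s : Finset ι) {f : ι → ℝ} {α : ℝ} (hα : 1 ≤ α)
    (hf : ∀ i ∈ s, 0 ≤ f i) :
    ∑ i ∈ s, f i ^ (1 / α) ≤ (#s : ℝ) ^ (1 - 1 / α) * (∑ i ∈ s, f i) ^ (1 / α) := by
  have hα0 : 0 < α := by linarith
  have hnn : ∀ i ∈ s, 0 ≤ f i ^ (1 / α) := fun i hi => Real.rpow_nonneg (hf i hi) _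
  have h := Real.rpow_sum_le_const_mul_sum_rpow_of_nonneg s hα hnn
  have hpow : ∑ i ∈ s, (f i ^ (1 / α)) ^ α = ∑ i ∈ s, f i :=
    sum_congr rfl fun i hi => by
      rw [← Real.rpow_mul (hf i hi), one_div_mul_cancel hα0.ne', Real.rpow_one]
  rw [hpow] at h
  have h2 := Real.rpow_le_rpow (Real.rpow_nonneg (sum_nonneg hnn) _) h (by positivity : 0 ≤ 1 / α)
  rw [← Real.rpow_mul (sum_nonneg hnn), mul_one_div_cancel hα0.ne', Real.rpow_one,
    Real.mul_rpow (by positivity) (sum_nonneg hf), ← Real.rpow_mul (by positivity)] at h2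
  have e : (α - 1) * (1 / α) = 1 - 1 / α := by field_simp
  rwa [e] at h2

/-- If the mass `d` on a layer exceeds that on the previous layer by at most the mass of `off`
on the previous layer, then the total mass of `d` is at most `H` times that of `off`. -/
lemma sum_le_mul_of_layer_step {S : Type*} [Fintype S] {H : ℕ} {layer : S → ℕ}
    (hlayer : ∀ s, 1 ≤ layer s ∧ layer s ≤ H) {d off : S → ℝ} (hoff : ∀ s, 0 ≤ off s)
    (h1 : ∑ s with layer s = 1, d s ≤ 0)
    (hstep : ∀ n, 1 ≤ n →
      ∑ s with layer s = n + 1, d s ≤ ∑ s with layer s = n, (d s + off s)) :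
    ∑ s, d s ≤ H * ∑ s, off s := by
  have key : ∀ n, 1 ≤ n → ∑ s with layer s = n, d s ≤ ∑ s with layer s < n, off s := by
    intro n hn
    induction n, hn using Nat.le_induction with
    | base => exact h1.trans (sum_nonneg fun s _ => hoff s)
    | succ n hn ih =>
      have hsplit : ∑ s with layer s < n + 1, off s
          = ∑ s with layer s < n, off s + ∑ s with layer s = n, off s := by
        rw [← sum_union]
        · congr 1
          ext s
          simp only [mem_filter, mem_union, mem_univ, true_and]
          omega
        · rw [disjoint_filter]
          intros
          omega
      have := hstep n hn
      rw [sum_add_distrib] at this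
      linarith
  have hfib : ∑ n ∈ Icc 1 H, ∑ s with layer s = n, d s = ∑ s, d s :=
    sum_fiberwise_of_maps_to (fun s _ => mem_Icc.2 (hlayer s)) d
  rw [← hfib]
  calc ∑ n ∈ Icc 1 H, ∑ s with layer s = n, d s
      ≤ ∑ n ∈ Icc 1 H, ∑ s, off s := sum_le_sum fun n hn =>
        (key n (mem_Icc.1 hn).1).trans
          (sum_le_sum_of_subset_of_nonneg (filter_subset _ _) fun s _ _ => hoff s)
    _ = H * ∑ s, off s := by simp

lemma occupancy_nonneg {S A : Type*} [Fintype S] [Fintype A] {layer : S → ℕ}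
    (hlayer : ∀ s, 1 ≤ layer s) {s1 : S} (hs1 : ∀ s, layer s = 1 ↔ s = s1)
    {P : S → A → S → ℝ} (hP_nonneg : ∀ s a s', 0 ≤ P s a s')
    (hP_supp : ∀ s a s', P s a s' ≠ 0 → layer s' = layer s + 1)
    {π x : S → A → ℝ} (hπ : ∀ s a, 0 ≤ π s a) (hx_init : ∀ a, x s1 a = π s1 a)
    (hx_rec : ∀ s' a', 2 ≤ layer s' → x s' a' = π s' a' * ∑ s, ∑ a, P s a s' * x s a)
    (s : S) (a : A) : 0 ≤ x s a := by
  induction hn : layer s using Nat.strong_induction_on generalizing s a with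
  | _ n ih =>
    by_cases h1 : layer s = 1
    · rw [(hs1 s).1 h1, hx_init]
      exact hπ _ _
    · have := hlayer s
      rw [hx_rec s a (by omega)]
      refine mul_nonneg (hπ _ _) (sum_nonneg fun r _ => sum_nonneg fun b _ => ?_)
      by_cases hP : P r b s = 0
      · simp [hP]
      · have := hP_supp _ _ _ hP
        exact mul_nonneg (hP_nonneg _ _ _) (ih (layer r) (by omega) r b rfl)

lemma sum_eq_add_sum_filter_ne {A : Type*} [Fintype A] [DecidableEq A] (f : A → ℝ) (b : A) :
    ∑ a, f a = f b + ∑ a ∈ univ.filter (fun a => a ≠ b), f a := by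
  rw [filter_ne', add_sum_erase _ _ (mem_univ b)]

/-- The total mass by which the occupancy measure of `π` along the deterministic policy `πd` can
exceed the occupancy measure of `πd` is at most `H` times the mass of the deviating actions. -/
lemma sum_occupancy_excess_le {S A : Type*} [Fintype S] [Fintype A] [DecidableEq A]
    {H : ℕ} {layer : S → ℕ} (hlayer : ∀ s : S, 1 ≤ layer s ∧ layer s ≤ H)
    {s1 : S} (hs1 : ∀ s : S, (layer s = 1 ↔ s = s1))
    {P : S → A → S → ℝ} (hP_nonneg : ∀ s a s', 0 ≤ P s a s')
    (hP_supp : ∀ s a s', P s a s' ≠ 0 → layer s' = layer s + 1)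
    (hP_sum : ∀ s a, layer s < H → ∑ s', P s a s' = 1)
    {π : S → A → ℝ} (hπ_nonneg : ∀ s a, 0 ≤ π s a) (hπ_sum : ∀ s, ∑ a, π s a = 1)
    {x : S → A → ℝ} (hx_nonneg : ∀ s a, 0 ≤ x s a) (hx_init : ∀ a, x s1 a = π s1 a)
    (hx_rec : ∀ s' a', 2 ≤ layer s' → x s' a' = π s' a' * ∑ s, ∑ a, P s a s' * x s a)
    {πd : S → A} {ρ : S → A → ℝ} (hρ_init : ∀ a, ρ s1 a = if a = πd s1 then (1 : ℝ) else 0)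
    (hρ_rec : ∀ s' a', 2 ≤ layer s' →
      ρ s' a' = (if a' = πd s' then (1 : ℝ) else 0) * ∑ s, ∑ a, P s a s' * ρ s a) :
    ∑ s, max (x s (πd s) - ρ s (πd s)) 0
      ≤ H * ∑ s, ∑ a ∈ univ.filter (fun a => a ≠ πd s), x s a := by
  set d : S → ℝ := fun s => max (x s (πd s) - ρ s (πd s)) 0 with hd
  set off : S → ℝ := fun s => ∑ a ∈ univ.filter (fun a => a ≠ πd s), x s a with hoff
  have hd_nonneg : ∀ s, 0 ≤ d s := fun s => le_max_right _ _
  have hπ_le : ∀ s a, π s a ≤ 1 := fun s a =>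
    hπ_sum s ▸ single_le_sum (fun b _ => hπ_nonneg s b) (mem_univ a)
  have hρ_off : ∀ s a, a ≠ πd s → ρ s a = 0 := by
    intro s a ha
    by_cases h1 : layer s = 1
    · obtain rfl := (hs1 s).1 h1
      rw [hρ_init, if_neg ha]
    · have := (hlayer s).1
      rw [hρ_rec s a (by omega), if_neg ha, zero_mul]
  have hP_le : ∀ s a, ∑ s', P s a s' ≤ 1 := by
    intro s a
    by_cases h : layer s < H
    · exact (hP_sum s a h).le
    · refine (sum_eq_zero fun s' _ => ?_).trans_le zero_le_one
      by_contra hP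
      have := hP_supp _ _ _ hP
      have := (hlayer s').2
      omega
  refine sum_le_mul_of_layer_step hlayer (fun s => sum_nonneg fun a _ => hx_nonneg s a) ?_ ?_
  · refine (sum_eq_zero fun s hs => ?_).le
    obtain rfl := (hs1 s).1 (mem_filter.1 hs).2
    refine max_eq_right ?_
    rw [hx_init, hρ_init, if_pos rfl]
    linarith [hπ_le s (πd s)]
  · intro n hn
    set g : S → S → ℝ := fun s s' =>
      P s (πd s) s' * d s + ∑ a ∈ univ.filter (fun a => a ≠ πd s), P s a s' * x s a with hg
    have hg_nonneg : ∀ s s', 0 ≤ g s s' := fun s s' =>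
      add_nonneg (mul_nonneg (hP_nonneg _ _ _) (hd_nonneg s))
        (sum_nonneg fun a _ => mul_nonneg (hP_nonneg _ _ _) (hx_nonneg _ _))
    have hd_le : ∀ s', layer s' = n + 1 → d s' ≤ ∑ s with layer s = n, g s s' := by
      intro s' hs'
      refine max_le ?_ (sum_nonneg fun s _ => hg_nonneg s s')
      have hrestrict : ∑ s with layer s = n, g s s' = ∑ s, g s s' := by
        refine sum_subset (filter_subset _ _) fun s _ hs => ?_
        have hP : ∀ a, P s a s' = 0 := by
          intro a
          by_contra hP
          have := hP_supp _ _ _ hP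
          exact hs (mem_filter.2 ⟨mem_univ _, by omega⟩)
        simp [hg, hP]
      rw [hrestrict, hx_rec s' _ (by omega), hρ_rec s' _ (by omega), if_pos rfl, one_mul]
      have hflow : 0 ≤ ∑ s, ∑ a, P s a s' * x s a :=
        sum_nonneg fun s _ => sum_nonneg fun a _ => mul_nonneg (hP_nonneg _ _ _) (hx_nonneg _ _)
      refine (sub_le_sub_right (mul_le_of_le_one_left hflow (hπ_le _ _)) _).trans ?_
      rw [← sum_sub_distrib]
      refine sum_le_sum fun s _ => ?_
      rw [sum_eq_add_sum_filter_ne _ (πd s), sum_eq_add_sum_filter_ne (fun a => P s a s' * ρ s a)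
        (πd s), sum_eq_zero (s := univ.filter (fun a => a ≠ πd s)) (f := fun a => P s a s' * ρ s a)
        fun a ha => by rw [hρ_off s a (mem_filter.1 ha).2, mul_zero]]
      have := mul_le_mul_of_nonneg_left (le_max_left (x s (πd s) - ρ s (πd s)) 0)
        (hP_nonneg s (πd s) s')
      simp only [hg, hd]
      linarith
    calc ∑ s' with layer s' = n + 1, d s'
        ≤ ∑ s' with layer s' = n + 1, ∑ s with layer s = n, g s s' :=
          sum_le_sum fun s' hs' => hd_le s' (mem_filter.1 hs').2
      _ = ∑ s with layer s = n, ∑ s' with layer s' = n + 1, g s s' := sum_comm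
      _ ≤ ∑ s with layer s = n, (d s + off s) := by
          refine sum_le_sum fun s _ => ?_
          refine (sum_le_sum_of_subset_of_nonneg (filter_subset _ _)
            fun s' _ _ => hg_nonneg s s').trans ?_
          rw [sum_add_distrib, sum_comm, ← sum_mul]
          refine add_le_add (mul_le_of_le_one_left (hd_nonneg s) (hP_le _ _))
            (sum_le_sum fun a _ => ?_)
          rw [← sum_mul]
          exact mul_le_of_le_one_left (hx_nonneg s a) (hP_le _ _)

theorem stmt_8
    {S A : Type*} [Fintype S] [Fintype A] [Nonempty S] [Nonempty A]
    [DecidableEq S] [DecidableEq A]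
    (H : ℕ) (hH : 1 ≤ H)
    (layer : S → ℕ)
    (hlayer : ∀ s : S, 1 ≤ layer s ∧ layer s ≤ H)
    (hlayer_ne : ∀ h : ℕ, 1 ≤ h → h ≤ H → ∃ s : S, layer s = h)
    (s1 : S) (hs1 : ∀ s : S, (layer s = 1 ↔ s = s1))
    (P : S → A → S → ℝ)
    (hP_nonneg : ∀ s a s', 0 ≤ P s a s')
    (hP_supp : ∀ s a s', P s a s' ≠ 0 → layer s' = layer s + 1)
    (hP_sum : ∀ s a, layer s < H → ∑ s', P s a s' = 1)
    (π : S → A → ℝ)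
    (hπ_nonneg : ∀ s a, 0 ≤ π s a)
    (hπ_sum : ∀ s, ∑ a, π s a = 1)
    (x : S → A → ℝ)
    (hx_init : ∀ a, x s1 a = π s1 a)
    (hx_rec : ∀ s' a', 2 ≤ layer s' → x s' a' = π s' a' * ∑ s, ∑ a, P s a s' * x s a)
    (πd : S → A)
    (ρ : S → A → ℝ)
    (hρ_init : ∀ a, ρ s1 a = if a = πd s1 then (1:ℝ) else 0)
    (hρ_rec : ∀ s' a', 2 ≤ layer s' →
      ρ s' a' = (if a' = πd s' then (1:ℝ) else 0) * ∑ s, ∑ a, P s a s' * ρ s a)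
    (α σ β : ℝ) (hα1 : 1 < α) (hα2 : α ≤ 2) (hσ : 0 < σ) (hβ : 0 < β)
    (t : ℕ) (ht : 2 ≤ t)
    (Ψ : ℕ → (S → A → ℝ) → ℝ)
    (hΨ : ∀ (n : ℕ) (z : S → A → ℝ),
      Ψ n z = -(σ * (n : ℝ) ^ (1/α) / β) * ∑ s, ∑ a, z s a ^ (1/α)) :
    (Ψ t ρ - Ψ (t - 1) ρ) - (Ψ t x - Ψ (t - 1) x) ≤
      (2 + 2 * (H : ℝ) ^ (1/α) * (Fintype.card S : ℝ) ^ (1 - 1/α)) * (σ / β) *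
        (t : ℝ) ^ (1/α - 1) *
        ∑ s, ∑ a ∈ Finset.univ.filter (fun a => a ≠ πd s), x s a ^ (1/α) := by
  have hα0 : 0 < α := by linarith
  have hp0 : 0 < 1 / α := by positivity
  have hp1 : 1 / α ≤ 1 := (div_le_one hα0).2 hα1.le
  have hx : ∀ s a, 0 ≤ x s a :=
    occupancy_nonneg (fun s => (hlayer s).1) hs1 hP_nonneg hP_supp hπ_nonneg hx_init hx_rec
  have hρ : ∀ s a, 0 ≤ ρ s a :=
    occupancy_nonneg (π := fun s a => if a = πd s then (1 : ℝ) else 0) (fun s => (hlayer s).1)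
      hs1 hP_nonneg hP_supp (fun s a => by split_ifs <;> norm_num) hρ_init hρ_rec
  set p : ℝ := 1 / α with hp
  set d : S → ℝ := fun s => max (x s (πd s) - ρ s (πd s)) 0 with hd
  set E : ℝ := ∑ s, ∑ a ∈ univ.filter (fun a => a ≠ πd s), x s a ^ p with hE
  set C : ℝ := (H : ℝ) ^ p * (Fintype.card S : ℝ) ^ (1 - p) with hC
  have hd_nonneg : ∀ s, 0 ≤ d s := fun s => le_max_right _ _
  have hE_nonneg : 0 ≤ E :=
    sum_nonneg fun s _ => sum_nonneg fun a _ => Real.rpow_nonneg (hx s a) _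
  have hC_nonneg : 0 ≤ C := by positivity
  have hoff_nonneg : ∀ s, 0 ≤ ∑ a ∈ univ.filter (fun a => a ≠ πd s), x s a :=
    fun s => sum_nonneg fun a _ => hx s a
  have hoff : (∑ s, ∑ a ∈ univ.filter (fun a => a ≠ πd s), x s a) ^ p ≤ E :=
    (rpow_sum_le_sum_rpow _ hp0 hp1 fun s _ => hoff_nonneg s).trans
      (sum_le_sum fun s _ => rpow_sum_le_sum_rpow _ hp0 hp1 fun a _ => hx s a)
  have hd_sum : ∑ s, d s ^ p ≤ C * E := by
    have hexcess : ∑ s, d s ≤ H * ∑ s, ∑ a ∈ univ.filter (fun a => a ≠ πd s), x s a :=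
      sum_occupancy_excess_le hlayer hs1 hP_nonneg hP_supp hP_sum hπ_nonneg hπ_sum hx hx_init
        hx_rec hρ_init hρ_rec
    calc ∑ s, d s ^ p
        ≤ (Fintype.card S : ℝ) ^ (1 - p) * (∑ s, d s) ^ p :=
          sum_rpow_one_div_le univ hα1.le fun s _ => hd_nonneg s
      _ ≤ (Fintype.card S : ℝ) ^ (1 - p) *
            (H * ∑ s, ∑ a ∈ univ.filter (fun a => a ≠ πd s), x s a) ^ p := by
          gcongr
      _ ≤ (Fintype.card S : ℝ) ^ (1 - p) * ((H : ℝ) ^ p * E) := by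
          rw [Real.mul_rpow (by positivity) (sum_nonneg fun s _ => hoff_nonneg s)]
          gcongr
      _ = C * E := by ring
  have hdiff : ∑ s, ∑ a, x s a ^ p - ∑ s, ∑ a, ρ s a ^ p ≤ (1 + C) * E := by
    have hpt : ∀ s, ∑ a, x s a ^ p - ∑ a, ρ s a ^ p
        ≤ d s ^ p + ∑ a ∈ univ.filter (fun a => a ≠ πd s), x s a ^ p := by
      intro s
      have h1 : x s (πd s) ^ p ≤ ρ s (πd s) ^ p + d s ^ p :=
        (Real.rpow_le_rpow (hx _ _) (by linarith [le_max_left (x s (πd s) - ρ s (πd s)) 0])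
          hp0.le).trans (Real.rpow_add_le_add_rpow (hρ _ _) (hd_nonneg s) hp0.le hp1)
      have h2 : ρ s (πd s) ^ p ≤ ∑ a, ρ s a ^ p :=
        single_le_sum (f := fun a => ρ s a ^ p) (fun a _ => Real.rpow_nonneg (hρ s a) _)
          (mem_univ _)
      rw [sum_eq_add_sum_filter_ne (fun a => x s a ^ p) (πd s)]
      linarith
    rw [← sum_sub_distrib]
    refine (sum_le_sum fun s _ => hpt s).trans ?_
    rw [sum_add_distrib]
    linarith
  have ht1 : (1 : ℝ) < t := by exact_mod_cast ht
  have hc_le := rpow_sub_rpow_sub_one_le ht1 hp1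
  have hc_nonneg : 0 ≤ (t : ℝ) ^ p - ((t : ℝ) - 1) ^ p :=
    sub_nonneg.2 (Real.rpow_le_rpow (by linarith) (by linarith) hp0.le)
  have hcast : ((t - 1 : ℕ) : ℝ) = (t : ℝ) - 1 := by
    rw [Nat.cast_sub (by omega), Nat.cast_one]
  have hCE : 0 ≤ (1 + C) * E := by positivity
  simp only [hΨ, hcast]
  calc _ = (σ / β) * (((t : ℝ) ^ p - ((t : ℝ) - 1) ^ p) *
          (∑ s, ∑ a, x s a ^ p - ∑ s, ∑ a, ρ s a ^ p)) := by ring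
    _ ≤ (σ / β) * ((t : ℝ) ^ (p - 1) * ((1 + C) * E)) := by
        gcongr ?_ * ?_
        exact (mul_le_mul_of_nonneg_left hdiff hc_nonneg).trans
          (mul_le_mul_of_nonneg_right hc_le hCE)
    _ ≤ 2 * ((σ / β) * ((t : ℝ) ^ (p - 1) * ((1 + C) * E))) :=
        le_mul_of_one_le_left (by positivity) one_le_two
    _ = _ := by rw [hC]; ring
end
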